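/- arXiv:1305.1984 — 5 statements merged into one kernel-verified Lean document; each statement's English description precedes it below -/
import Mathlib

section
/- For all integers n, m with 1 ≤ m ≤ n, E_m[1/ℓ] = (−1)^{m+1}·(m/n)·C(n,m) + m·C(n,m)·Σ_{j=1}^{m−1} (−1)^{m−j}·C(m−1,j)·ln(1 − j/n)/j, where ln is the natural logarithm. (This is the finite closed-form formula of the paper's lemma; the paper's displayed first term n!/(n−m)!·(−1)^{m+1} is a typo, and the first term produced by its proof is (−1)^{m+1}·(m/n)·C(n,m), which can be interpreted as the j = 0 term of the sum.) -/
/-- `stirling2 a b` is the Stirling number of the second kind: the number of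
partitions of an `a`-element set into `b` nonempty blocks. -/
def stirling2 : ℕ → ℕ → ℕ
  | 0, 0 => 1
  | 0, _ + 1 => 0
  | _ + 1, 0 => 0
  | a + 1, b + 1 => (b + 1) * stirling2 a (b + 1) + stirling2 a b

/-- `E_m[1/ℓ] := m!·C(n,m)·Σ_{ℓ=m}^∞ S(ℓ−1, m−1)/(ℓ·n^ℓ)`, the expected reciprocal of
the waiting time until `m` distinct values have appeared in i.i.d. uniform draws from an
`n`-element set. -/
noncomputable def Erecip (n m : ℕ) : ℝ :=
  (m.factorial * n.choose m : ℝ) *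
    ∑' ℓ : ℕ, if m ≤ ℓ then (stirling2 (ℓ - 1) (m - 1) : ℝ) / (ℓ * n ^ ℓ) else 0

lemma stirling2_explicit (a : ℕ) : ∀ k : ℕ, (k.factorial : ℝ) * stirling2 a k =
    ∑ j ∈ Finset.range (k + 1), (-1 : ℝ) ^ (k + j) * (k.choose j : ℝ) * (j : ℝ) ^ a := by
  induction a with
  | zero =>
    intro k
    have h := add_pow (1 : ℝ) (-1) k
    have h2 := Int.alternating_sum_range_choose (n := k)
    have h3 : (∑ j ∈ Finset.range (k + 1), (-1 : ℝ) ^ j * (k.choose j : ℝ)) =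
        if k = 0 then 1 else 0 := by exact_mod_cast h2
    have h4 : ∑ j ∈ Finset.range (k + 1), (-1 : ℝ) ^ (k + j) * (k.choose j : ℝ) * (j : ℝ) ^ 0
        = (-1) ^ k * ∑ j ∈ Finset.range (k + 1), (-1 : ℝ) ^ j * (k.choose j : ℝ) := by
      rw [Finset.mul_sum]
      refine Finset.sum_congr rfl fun j _ => ?_
      rw [pow_add]; ring
    rw [h4, h3]
    cases k <;> simp [stirling2]
  | succ a ih =>
    intro k
    cases k with
    | zero => simp [stirling2]
    | succ k =>
      have e : ((k + 1).factorial : ℝ) * stirling2 (a + 1) (k + 1) =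
          (k + 1) * (((k + 1).factorial : ℝ) * stirling2 a (k + 1)
            + (k.factorial : ℝ) * stirling2 a k) := by
        simp only [stirling2, Nat.factorial_succ]; push_cast; ring
      have e2 : ∑ j ∈ Finset.range (k + 1), (-1 : ℝ) ^ (k + j) * (k.choose j : ℝ) * (j : ℝ) ^ a
          = ∑ j ∈ Finset.range (k + 1 + 1),
            (-1 : ℝ) ^ (k + j) * (k.choose j : ℝ) * (j : ℝ) ^ a := by
        rw [Finset.sum_range_succ _ (k + 1)]; simp
      rw [e, ih, ih, e2, ← Finset.sum_add_distrib, Finset.mul_sum]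
      refine Finset.sum_congr rfl fun j _ => ?_
      cases j with
      | zero => simp [pow_succ]
      | succ j =>
        have c1 : ((k + 1 : ℕ) : ℝ) * (k.choose j : ℝ) = ((k + 1).choose (j + 1) : ℝ) * (j + 1 : ℕ) := by
          exact_mod_cast Nat.add_one_mul_choose_eq k j
        have c2 : ((k + 1).choose (j + 1) : ℝ) = k.choose j + k.choose (j + 1) := by
          exact_mod_cast Nat.choose_succ_succ k j
        have c3 : (-1 : ℝ) ^ (k + 1 + (j + 1)) = (-1) ^ (k + j) := by
          rw [show k + 1 + (j + 1) = k + j + 2 by ring, pow_add]; simp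
        have c4 : (-1 : ℝ) ^ (k + (j + 1)) = - (-1) ^ (k + j) := by
          rw [← add_assoc, pow_succ]; ring
        rw [c3, c4, pow_succ ((j + 1 : ℕ) : ℝ) a]
        push_cast at c1 ⊢
        linear_combination (-1 : ℝ) ^ (k + j) * ((j : ℝ) + 1) ^ a * (c1 + (k + 1) * c2)

lemma stirling2_lt (a : ℕ) : ∀ k : ℕ, a < k → stirling2 a k = 0 := by
  induction a with
  | zero => intro k hk; cases k <;> simp_all [stirling2]
  | succ a ih =>
    intro k hk
    cases k with
    | zero => omega
    | succ k => simp [stirling2, ih (k + 1) (by omega), ih k (by omega)]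

lemma hasSum_aux (n j : ℕ) (hj : j < n) :
    HasSum (fun a : ℕ => (j : ℝ) ^ a / (((a + 1 : ℕ) : ℝ) * (n : ℝ) ^ (a + 1)))
      (if j = 0 then 1 / (n : ℝ) else - (Real.log (1 - (j : ℝ) / n) / j)) := by
  have hn : (n : ℝ) ≠ 0 := by
    have : n ≠ 0 := by omega
    exact_mod_cast this
  split_ifs with h
  · subst h
    have h0 := hasSum_single (f := fun a : ℕ => ((0 : ℕ) : ℝ) ^ a /
      (((a + 1 : ℕ) : ℝ) * (n : ℝ) ^ (a + 1))) (0 : ℕ) (by intro b hb; simp [hb])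
    simpa using h0
  · have hj0 : (j : ℝ) ≠ 0 := by exact_mod_cast h
    have hlt : |(j : ℝ) / n| < 1 := by
      rw [abs_of_nonneg (by positivity), div_lt_one (by positivity)]
      exact_mod_cast hj
    have := (Real.hasSum_pow_div_log_of_abs_lt_one hlt).mul_left (1 / (j : ℝ))
    convert! this using 1
    · funext a
      have : (a : ℝ) + 1 ≠ 0 := by positivity
      push_cast
      rw [div_pow, pow_succ (j : ℝ)]
      field_simp
    · ring

theorem Erecip_closed_form (n m : ℕ) (hm : 1 ≤ m) (hmn : m ≤ n) :
    Erecip n m = (-1 : ℝ) ^ (m + 1) * ((m : ℝ) / n) * (n.choose m : ℝ)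
      + (m : ℝ) * (n.choose m : ℝ) *
        ∑ j ∈ Finset.Icc 1 (m - 1),
          (-1 : ℝ) ^ (m - j) * ((m - 1).choose j : ℝ) * Real.log (1 - (j : ℝ) / n) / j := by
  obtain ⟨k, rfl⟩ : ∃ k, m = k + 1 := ⟨m - 1, by omega⟩
  have hk : (k.factorial : ℝ) ≠ 0 := by exact_mod_cast k.factorial_ne_zero
  have H := (hasSum_sum (s := Finset.range (k + 1)) (fun j hj =>
    (hasSum_aux n j (by have := Finset.mem_range.1 hj; omega)).mul_left
      ((-1 : ℝ) ^ (k + j) * (k.choose j : ℝ)))).mul_left (1 / (k.factorial : ℝ))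
  have H2 : HasSum (fun ℓ : ℕ => if k + 1 ≤ ℓ then
      (stirling2 (ℓ - 1) (k + 1 - 1) : ℝ) / (ℓ * n ^ ℓ) else 0)
      (1 / (k.factorial : ℝ) * ∑ j ∈ Finset.range (k + 1), (-1 : ℝ) ^ (k + j) * (k.choose j : ℝ) *
        (if j = 0 then 1 / (n : ℝ) else - (Real.log (1 - (j : ℝ) / n) / j))) := by
    rw [← hasSum_nat_add_iff' 1]
    convert! H using 1
    · funext a
      have e := stirling2_explicit a k
      have e' : (stirling2 a k : ℝ) = 1 / (k.factorial : ℝ) *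
        ∑ j ∈ Finset.range (k + 1), (-1 : ℝ) ^ (k + j) * (k.choose j : ℝ) * (j : ℝ) ^ a := by
        rw [← e]; field_simp
      have e2 : (if k + 1 ≤ a + 1 then
          (stirling2 (a + 1 - 1) (k + 1 - 1) : ℝ) / (((a + 1 : ℕ) : ℝ) * (n : ℝ) ^ (a + 1)) else 0)
          = (stirling2 a k : ℝ) / (((a + 1 : ℕ) : ℝ) * (n : ℝ) ^ (a + 1)) := by
        split_ifs with h
        · simp
        · rw [stirling2_lt a k (by omega)]; simp
      rw [e2, e', mul_div_assoc, Finset.sum_div]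
      congr 1
      exact Finset.sum_congr rfl fun j _ => by rw [mul_div_assoc]
    · simp
  rw [Erecip, H2.tsum_eq, Finset.sum_range_succ']
  have S : ∑ j ∈ Finset.Icc 1 (k + 1 - 1), (-1 : ℝ) ^ (k + 1 - j) * ((k + 1 - 1).choose j : ℝ) *
      Real.log (1 - (j : ℝ) / n) / j = ∑ j ∈ Finset.range k, (-1 : ℝ) ^ (k + (j + 1)) *
        (k.choose (j + 1) : ℝ) * (if j + 1 = 0 then 1 / (n : ℝ) else
          - (Real.log (1 - ((j + 1 : ℕ) : ℝ) / n) / ((j + 1 : ℕ) : ℝ))) := by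
    rw [Finset.range_eq_Ico, Finset.sum_Ico_add' (fun j : ℕ => (-1 : ℝ) ^ (k + j) *
        (k.choose j : ℝ) * (if j = 0 then 1 / (n : ℝ) else
          - (Real.log (1 - (j : ℝ) / n) / (j : ℝ)))) 0 k 1]
    refine Finset.sum_congr (by ext; simp [Finset.mem_Icc, Finset.mem_Ico] <;> omega) fun j hj => ?_
    have hj' := Finset.mem_Ico.1 hj
    rw [if_neg (by omega)]
    obtain ⟨d, rfl⟩ : ∃ d, k = j + d := ⟨k - j, by omega⟩
    have s1 : (-1 : ℝ) ^ (j + d + 1 - j) = - (-1) ^ d := by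
      rw [show j + d + 1 - j = d + 1 by omega, pow_succ]; ring
    have s2 : (-1 : ℝ) ^ (j + d + j) = (-1) ^ d := by
      rw [show j + d + j = 2 * j + d by ring, pow_add, pow_mul]; simp
    rw [s1, s2]
    simp only [Nat.add_sub_cancel]
    ring
  rw [S, Nat.factorial_succ]
  generalize (∑ j ∈ Finset.range k, _ : ℝ) = X
  simp only [pow_succ, Nat.choose_zero_right, if_true]
  push_cast
  field_simp
  ring
end

section
/- For all integers n, m with 1 < m and m² < 2n (i.e. m < √(2n)), one has E_m[1/ℓ] < 1/E_{m−1}[ℓ], where E_{m−1}[ℓ] = Σ_{j=0}^{m−2} n/(n−j). -/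
/-- `E_m[ℓ] := Σ_{j=0}^{m−1} n/(n−j)`, the expected waiting time until `m` distinct values
have appeared in i.i.d. uniform draws from an `n`-element set. -/
noncomputable def Ewait (n m : ℕ) : ℝ :=
  ∑ j ∈ Finset.range m, (n : ℝ) / ((n : ℝ) - j)

theorem aux_rec_hasSum (a b : ℕ → ℝ) (q B : ℝ) (hq0 : 0 ≤ q) (hq : q < 1)
    (ha : ∀ l, 0 ≤ a l) (hb : ∀ l, 0 ≤ b l) (h0 : a 0 = 0)
    (hrec : ∀ l, a (l + 1) = q * a l + b l) (hB : HasSum b B) :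
    HasSum a (B / (1 - q)) := by
  have hq' : 0 < 1 - q := by linarith
  have hbd : ∀ N, ∑ i ∈ Finset.range N, a i ≤ B / (1 - q) := by
    intro N
    have h1 : ∑ i ∈ Finset.range (N + 1), a i
        = q * ∑ i ∈ Finset.range N, a i + ∑ i ∈ Finset.range N, b i := by
      rw [Finset.sum_range_succ', h0, Finset.mul_sum, ← Finset.sum_add_distrib, add_zero]
      exact Finset.sum_congr rfl fun i _ => hrec i
    rw [Finset.sum_range_succ] at h1
    have h2 : ∑ i ∈ Finset.range N, b i ≤ B := sum_le_hasSum _ (fun i _ => hb i) hB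
    rw [le_div_iff₀ hq']
    nlinarith [ha N]
  have hs : Summable a := summable_of_sum_range_le ha hbd
  have h3 : ∑' l, a l = q * ∑' l, a l + B := by
    conv_lhs => rw [hs.tsum_eq_zero_add, h0, zero_add]
    simp_rw [hrec]
    rw [(hs.mul_left q).tsum_add hB.summable, tsum_mul_left, hB.tsum_eq]
  have h4 : ∑' l, a l = B / (1 - q) := by
    rw [eq_div_iff hq'.ne']; linarith
  rw [← h4]; exact hs.hasSum

noncomputable def auxP (n k l : ℕ) : ℝ :=
  if k + 1 ≤ l then (n.descFactorial (k + 1) : ℝ) * (stirling2 (l - 1) k : ℝ) / n ^ l else 0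

theorem aux_stirling_zero : ∀ a b : ℕ, a < b → stirling2 a b = 0
  | 0, 0, h => by omega
  | 0, b + 1, _ => by simp [stirling2]
  | a + 1, 0, h => by omega
  | a + 1, b + 1, h => by
    rw [stirling2, aux_stirling_zero a (b + 1) (by omega), aux_stirling_zero a b (by omega)]
    simp

theorem auxP_nonneg (n k l : ℕ) : 0 ≤ auxP n k l := by
  unfold auxP; split_ifs <;> positivity

theorem auxP_rec (n k l : ℕ) (hk : k + 1 < n) :
    auxP n (k + 1) (l + 1) = ((k + 1 : ℕ) : ℝ) / n * auxP n (k + 1) l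
      + (1 - ((k + 1 : ℕ) : ℝ) / n) * auxP n k l := by
  have hn : (n : ℝ) ≠ 0 := by
    have : 0 < n := by omega
    positivity
  rcases l with _ | l
  · simp [auxP]
  have hD : (n.descFactorial (k + 1 + 1) : ℝ) = (n - ((k + 1 : ℕ) : ℝ)) * n.descFactorial (k + 1) := by
    rw [Nat.descFactorial_succ n (k + 1), Nat.cast_mul, Nat.cast_sub hk.le]
  by_cases h1 : k + 1 ≤ l
  · have e1 : auxP n (k + 1) (l + 1 + 1)
      = (n.descFactorial (k + 1 + 1) : ℝ) * (stirling2 (l + 1) (k + 1) : ℝ) / n ^ (l + 1 + 1) := by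
      unfold auxP; rw [if_pos (by omega)]; rfl
    have e2 : auxP n (k + 1) (l + 1)
      = (n.descFactorial (k + 1 + 1) : ℝ) * (stirling2 l (k + 1) : ℝ) / n ^ (l + 1) := by
      unfold auxP; rw [if_pos (by omega)]; rfl
    have e3 : auxP n k (l + 1)
      = (n.descFactorial (k + 1) : ℝ) * (stirling2 l k : ℝ) / n ^ (l + 1) := by
      unfold auxP; rw [if_pos (by omega)]; rfl
    rw [e1, e2, e3, stirling2, hD]
    push_cast
    field_simp
    try ring
  · by_cases h2 : k = l
    · subst h2
      have e1 : auxP n (k + 1) (k + 1 + 1)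
        = (n.descFactorial (k + 1 + 1) : ℝ) * (stirling2 (k + 1) (k + 1) : ℝ) / n ^ (k + 1 + 1) := by
        unfold auxP; rw [if_pos (by omega)]; rfl
      have e2 : auxP n (k + 1) (k + 1) = 0 := by
        unfold auxP; rw [if_neg (by omega)]
      have e3 : auxP n k (k + 1)
        = (n.descFactorial (k + 1) : ℝ) * (stirling2 k k : ℝ) / n ^ (k + 1) := by
        unfold auxP; rw [if_pos (by omega)]; rfl
      rw [e1, e2, e3, stirling2, hD, aux_stirling_zero k (k + 1) (by omega)]
      push_cast
      field_simp
      try ring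
    · unfold auxP
      rw [if_neg (by omega), if_neg (by omega), if_neg (by omega)]
      ring

noncomputable def auxV (n m : ℕ) : ℝ :=
  ∑ j ∈ Finset.range m, (j : ℝ) * n / ((n : ℝ) - j) ^ 2

theorem auxP_moments (n k : ℕ) (hk : k < n) :
    HasSum (auxP n k) 1 ∧ HasSum (fun l : ℕ => (l : ℝ) * auxP n k l) (Ewait n (k + 1)) ∧
    HasSum (fun l : ℕ => (l : ℝ) ^ 2 * auxP n k l) (auxV n (k + 1) + Ewait n (k + 1) ^ 2) := by
  induction k with
  | zero =>
    have hn : (n : ℝ) ≠ 0 := by positivity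
    have hz : ∀ l, l ≠ 1 → auxP n 0 l = 0 := by
      intro l hl
      unfold auxP
      split_ifs with h
      · obtain ⟨j, rfl⟩ : ∃ j, l = j + 2 := ⟨l - 2, by omega⟩
        simp [stirling2]
      · rfl
    have h1 : auxP n 0 1 = 1 := by simp [auxP, stirling2, hn]
    have hE : Ewait n (0 + 1) = 1 := by simp [Ewait, hn]
    have hV : auxV n (0 + 1) = 0 := by simp [auxV]
    rw [hE, hV]
    refine ⟨?_, ?_, ?_⟩
    · have := hasSum_single (f := auxP n 0) 1 hz
      rwa [h1] at this
    · have := hasSum_single (f := fun l : ℕ => (l : ℝ) * auxP n 0 l) 1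
        (fun l hl => by simp [hz l hl])
      simpa [h1] using this
    · have := hasSum_single (f := fun l : ℕ => (l : ℝ) ^ 2 * auxP n 0 l) 1
        (fun l hl => by simp [hz l hl])
      simpa [h1] using this
  | succ k ih =>
    obtain ⟨i0, i1, i2⟩ := ih (by omega)
    set μ := Ewait n (k + 1) with hμ
    set V := auxV n (k + 1) with hV
    have hn : (0 : ℝ) < n := by
      have : 0 < n := by omega
      positivity
    have hkn : ((k + 1 : ℕ) : ℝ) < n := by exact_mod_cast hk
    have hE : Ewait n (k + 1 + 1) = μ + n / (n - ((k + 1 : ℕ) : ℝ)) := by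
      simp only [hμ, Ewait]; rw [Finset.sum_range_succ]
    have hV' : auxV n (k + 1 + 1) = V + ((k + 1 : ℕ) : ℝ) * n / (n - ((k + 1 : ℕ) : ℝ)) ^ 2 := by
      simp only [hV, auxV]; rw [Finset.sum_range_succ]
    have hrec := fun l => auxP_rec n k l hk
    have hnn := auxP_nonneg n
    have h00 : auxP n (k + 1) 0 = 0 := by simp [auxP]
    rw [hE, hV']
    have hc0 : (0 : ℝ) ≤ ((k + 1 : ℕ) : ℝ) := by positivity
    generalize ((k + 1 : ℕ) : ℝ) = c at *
    obtain ⟨q, hqd⟩ : ∃ q, q = c / n := ⟨_, rfl⟩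
    rw [← hqd] at hrec
    have hq0 : 0 ≤ q := by rw [hqd]; positivity
    have hq1 : q < 1 := by rw [hqd, div_lt_one hn]; exact hkn
    have hq' : 0 < 1 - q := by linarith
    have hcq : c = q * n := by rw [hqd]; field_simp
    have t1 : (n : ℝ) / (n - c) = 1 / (1 - q) := by
      rw [hcq, div_eq_div_iff (by nlinarith) hq'.ne']; ring
    have t2 : c * n / (n - c) ^ 2 = q / (1 - q) ^ 2 := by
      have : (n : ℝ) - c = n * (1 - q) := by rw [hcq]; ring
      rw [this, hcq]; field_simp
    rw [t1, t2]
    have j0 : HasSum (auxP n (k + 1)) 1 := by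
      have := aux_rec_hasSum (auxP n (k + 1)) (fun l => (1 - q) * auxP n k l) q _ hq0 hq1
        (hnn _) (fun l => mul_nonneg hq'.le (hnn _ _)) h00 hrec (i0.mul_left (1 - q))
      rwa [mul_one, div_self hq'.ne'] at this
    have j1 : HasSum (fun l : ℕ => (l : ℝ) * auxP n (k + 1) l) (μ + 1 / (1 - q)) := by
      have := aux_rec_hasSum (fun l : ℕ => (l : ℝ) * auxP n (k + 1) l)
        (fun l => q * auxP n (k + 1) l + (1 - q) * ((l : ℝ) * auxP n k l + auxP n k l)) q _ hq0 hq1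
        (fun l => mul_nonneg (by positivity) (hnn _ _))
        (fun l => add_nonneg (mul_nonneg hq0 (hnn _ _))
          (mul_nonneg hq'.le (add_nonneg (mul_nonneg (by positivity) (hnn _ _)) (hnn _ _))))
        (by simp) (fun l => by push_cast; rw [hrec]; ring)
        ((j0.mul_left q).add ((i1.add i0).mul_left (1 - q)))
      convert this using 1
      field_simp
      ring
    refine ⟨j0, j1, ?_⟩
    have := aux_rec_hasSum (fun l : ℕ => (l : ℝ) ^ 2 * auxP n (k + 1) l)
      (fun l => q * (2 * ((l : ℝ) * auxP n (k + 1) l) + auxP n (k + 1) l)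
        + (1 - q) * ((l : ℝ) ^ 2 * auxP n k l + 2 * ((l : ℝ) * auxP n k l) + auxP n k l)) q _ hq0 hq1
      (fun l => mul_nonneg (by positivity) (hnn _ _))
      (fun l => by
        have := hnn k l
        have := hnn (k + 1) l
        have := hq'.le
        positivity)
      (by simp) (fun l => by push_cast; rw [hrec]; ring)
      ((((j1.mul_left 2).add j0).mul_left q).add (((i2.add (i1.mul_left 2)).add i0).mul_left (1 - q)))
    convert this using 1
    field_simp
    ring

theorem Erecip_lt_inv_Ewait (n m : ℕ) (hm : 1 < m) (hm2 : m ^ 2 < 2 * n) :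
    Erecip n m < 1 / Ewait n (m - 1) := by
  obtain ⟨k, rfl⟩ : ∃ k, m = k + 1 := ⟨m - 1, by omega⟩
  have hk : 2 * k < n := by
    zify at *
    nlinarith [sq_nonneg ((k : ℤ) - 1)]
  obtain ⟨i0, i1, i2⟩ := auxP_moments n k (by omega)
  have hn : (0 : ℝ) < n := by
    have : 0 < n := by omega
    positivity
  have hkR : 2 * (k : ℝ) < n := by exact_mod_cast hk
  have hk1 : (1 : ℝ) ≤ k := by exact_mod_cast (by omega : 1 ≤ k)
  have hform : Erecip n (k + 1) = ∑' l : ℕ, auxP n k l / l := by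
    unfold Erecip
    rw [← tsum_mul_left]
    congr 1; ext l
    unfold auxP
    rw [← Nat.cast_mul, ← Nat.descFactorial_eq_factorial_mul_choose]
    split_ifs with h
    · simp only [Nat.add_sub_cancel]
      rw [mul_div_assoc, mul_div_assoc, div_div, mul_comm (l : ℝ)]
    · simp
  have hE : Ewait n (k + 1) = Ewait n k + n / (n - k) := by
    simp only [Ewait]; rw [Finset.sum_range_succ]
  rw [Nat.add_sub_cancel, hform]
  have hd : (0 : ℝ) < n / (n - k) := div_pos hn (by linarith)
  have hA : 0 < Ewait n k := by
    unfold Ewait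
    apply Finset.sum_pos
    · intro j hj
      have : (j : ℝ) < k := by exact_mod_cast Finset.mem_range.mp hj
      exact div_pos hn (by linarith)
    · exact ⟨0, Finset.mem_range.mpr (by omega)⟩
  have hV : auxV n (k + 1) ≤ k * (n / (n - k)) := by
    unfold auxV
    rw [Finset.sum_range_succ']
    have : ∀ j ∈ Finset.range k, ((j + 1 : ℕ) : ℝ) * n / ((n : ℝ) - (j + 1 : ℕ)) ^ 2
        ≤ n / (n - k) := by
      intro j hj
      have hj' : ((j + 1 : ℕ) : ℝ) ≤ k := by exact_mod_cast Finset.mem_range.mp hj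
      have hj0 : (0 : ℝ) ≤ ((j + 1 : ℕ) : ℝ) := by positivity
      generalize ((j + 1 : ℕ) : ℝ) = c at *
      have h1 : 0 < (n : ℝ) - c := by linarith
      rw [div_le_div_iff₀ (by positivity) (by linarith)]
      have : c * (n - k) ≤ (n - c) ^ 2 := by nlinarith
      nlinarith
    have := Finset.sum_le_sum this
    simpa using this
  set A := Ewait n k
  set μ := Ewait n (k + 1)
  set V := auxV n (k + 1)
  set d := (n : ℝ) / (n - k)
  have hμ : 0 < μ := by linarith
  have hm0 : (0 : ℝ) < k + 1 := by linarith
  have hup : HasSum (fun l : ℕ => (1 / μ) * auxP n k l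
      - (1 / μ ^ 2) * ((l : ℝ) * auxP n k l - μ * auxP n k l)
      + (1 / (μ ^ 2 * (k + 1))) * ((l : ℝ) ^ 2 * auxP n k l - 2 * μ * ((l : ℝ) * auxP n k l)
        + μ ^ 2 * auxP n k l)) _ :=
    ((i0.mul_left (1 / μ)).sub ((i1.sub (i0.mul_left μ)).mul_left (1 / μ ^ 2))).add
      (((i2.sub (i1.mul_left (2 * μ))).add (i0.mul_left (μ ^ 2))).mul_left (1 / (μ ^ 2 * (k + 1))))
  have hle : ∀ l : ℕ, auxP n k l / l ≤ (1 / μ) * auxP n k l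
      - (1 / μ ^ 2) * ((l : ℝ) * auxP n k l - μ * auxP n k l)
      + (1 / (μ ^ 2 * (k + 1))) * ((l : ℝ) ^ 2 * auxP n k l - 2 * μ * ((l : ℝ) * auxP n k l)
        + μ ^ 2 * auxP n k l) := by
    intro l
    by_cases hl : k + 1 ≤ l
    · have hl' : (k : ℝ) + 1 ≤ l := by exact_mod_cast hl
      have hl0 : (0 : ℝ) < l := by linarith
      have e : 1 / (l : ℝ) = 1 / μ - (1 / μ ^ 2) * (l - μ) + (1 / (μ ^ 2 * l)) * (l - μ) ^ 2 := by
        field_simp; ring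
      have f : 1 / (μ ^ 2 * (l : ℝ)) ≤ 1 / (μ ^ 2 * (k + 1)) := by gcongr
      have g : 1 / (l : ℝ) ≤ 1 / μ - (1 / μ ^ 2) * (l - μ) + (1 / (μ ^ 2 * (k + 1))) * (l - μ) ^ 2 := by
        rw [e]; gcongr
      have := mul_le_mul_of_nonneg_left g (auxP_nonneg n k l)
      calc auxP n k l / l = auxP n k l * (1 / l) := by ring
        _ ≤ _ := this
        _ = _ := by ring
    · have : auxP n k l = 0 := by unfold auxP; rw [if_neg hl]
      simp [this]
  have hsum : Summable fun l : ℕ => auxP n k l / l :=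
    Summable.of_nonneg_of_le (fun l => div_nonneg (auxP_nonneg _ _ _) (by positivity)) hle hup.summable
  refine lt_of_le_of_lt (hasSum_le hle hsum.hasSum hup) ?_
  have e : 1 / μ * 1 - 1 / μ ^ 2 * (μ - μ * 1)
      + 1 / (μ ^ 2 * (k + 1)) * (V + μ ^ 2 - 2 * μ * μ + μ ^ 2 * 1)
      = (μ * (k + 1) + V) / (μ ^ 2 * (k + 1)) := by
    field_simp; ring
  rw [e, div_lt_div_iff₀ (by positivity) hA]
  have h1 : V * A ≤ k * d * A := mul_le_mul_of_nonneg_right hV hA.le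
  have h2 : A = μ - d := by linarith
  have h3 : k * d * A < (k + 1) * d * μ := by
    have : A < μ := by linarith
    have : k * d < (k + 1) * d := by linarith
    have : 0 < (k : ℝ) * d := by positivity
    nlinarith
  have h4 : (μ * (k + 1)) * A = μ ^ 2 * (k + 1) - (k + 1) * d * μ := by rw [h2]; ring
  nlinarith
end

section
/- For all integers n, m, j, ℓ, k with 1 ≤ m ≤ n, 1 ≤ j ≤ m−1, ℓ ≥ m, and k ≥ 1, the number of sequences χ ∈ 𝒳_m^{(ℓ)} with τ_j(χ) ≥ k equals j^k·|𝒳_m^{(ℓ−k)}| (where |𝒳_m^{(ℓ−k)}| = 0 if ℓ−k < m). -/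
/-- `pathSet n m ℓ` is the set `𝒳_m^{(ℓ)}` of sequences `(χ_1, …, χ_ℓ)` of length `ℓ`
with entries in an `n`-element set such that the set of entries has exactly `m` elements
and the last entry is distinct from all previous entries. -/
def pathSet (n m ℓ : ℕ) : Finset (Fin ℓ → Fin n) :=
  Finset.univ.filter (fun χ =>
    (Finset.image χ Finset.univ).card = m ∧
    ∀ t s : Fin ℓ, (t : ℕ) < ℓ - 1 → (s : ℕ) = ℓ - 1 → χ t ≠ χ s)

/-- `prior χ t` is the set `{χ_1, …, χ_{t−1}}` of values occurring strictly before
position `t` in the sequence `χ`. -/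
def prior {n ℓ : ℕ} (χ : Fin ℓ → Fin n) (t : Fin ℓ) : Finset (Fin n) :=
  (Finset.univ.filter (fun s => s < t)).image χ

/-- `tau j χ` is `τ_j(χ)`: the number of indices `t` with
`χ_t ∈ {χ_1, …, χ_{t−1}}` and `|{χ_1, …, χ_{t−1}}| = j`. -/
def tau {n ℓ : ℕ} (j : ℕ) (χ : Fin ℓ → Fin n) : ℕ :=
  (Finset.univ.filter (fun t => χ t ∈ prior χ t ∧ (prior χ t).card = j)).card

theorem aux_image {n ℓ : ℕ} (ψ : Fin ℓ → Fin n) (x : Fin n) :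
    Finset.image (Fin.snoc ψ x : Fin (ℓ+1) → Fin n) Finset.univ
      = insert x (Finset.image ψ Finset.univ) := by
  ext y
  simp [Fin.exists_fin_succ', or_comm, eq_comm]

theorem aux_prior_last {n ℓ : ℕ} (ψ : Fin ℓ → Fin n) (x : Fin n) :
    prior (Fin.snoc ψ x : Fin (ℓ+1) → Fin n) (Fin.last ℓ) = Finset.image ψ Finset.univ := by
  ext y
  simp [prior, Fin.exists_fin_succ', Fin.castSucc_lt_last]

theorem aux_prior_castSucc {n ℓ : ℕ} (ψ : Fin ℓ → Fin n) (x : Fin n) (t : Fin ℓ) :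
    prior (Fin.snoc ψ x : Fin (ℓ+1) → Fin n) t.castSucc = prior ψ t := by
  ext y
  simp [prior, Fin.exists_fin_succ', Fin.le_last]

theorem aux_tau {n ℓ : ℕ} (j : ℕ) (ψ : Fin ℓ → Fin n) (x : Fin n) :
    tau j (Fin.snoc ψ x : Fin (ℓ+1) → Fin n) = tau j ψ +
      if x ∈ Finset.image ψ Finset.univ ∧ (Finset.image ψ Finset.univ).card = j
        then 1 else 0 := by
  unfold tau
  rw [Finset.card_filter, Finset.card_filter, Fin.sum_univ_castSucc]
  simp only [aux_prior_last, aux_prior_castSucc, Fin.snoc_last, Fin.snoc_castSucc]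

theorem aux_sum {n : ℕ} (I : Finset (Fin n)) (A B : ℕ) :
    ∑ x : Fin n, (if x ∈ I then A else B) = I.card * A + (n - I.card) * B := by
  rw [Finset.sum_ite]
  simp only [Finset.sum_const, smul_eq_mul]
  congr 2
  · simp
  · rw [← Finset.compl_filter, Finset.card_compl]; simp

theorem aux_snoc {n ℓ : ℕ} (f : (Fin (ℓ+1) → Fin n) → ℕ) :
    ∑ χ, f χ = ∑ ψ : Fin ℓ → Fin n, ∑ x : Fin n, f (Fin.snoc ψ x : Fin (ℓ+1) → Fin n) := by
  rw [← Fintype.sum_prod_type_right', ← (Fin.snocEquiv (fun _ => Fin n)).sum_comp]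
  rfl

def auxW (n j ℓ a k : ℕ) : ℕ :=
  (Finset.univ.filter (fun χ : Fin ℓ → Fin n =>
    (Finset.image χ Finset.univ).card = a ∧ k ≤ tau j χ)).card

theorem auxW_succ (n j ℓ a k : ℕ) :
    auxW n j (ℓ+1) (a+1) k =
      (a+1) * auxW n j ℓ (a+1) (if a+1 = j then k-1 else k) + (n-a) * auxW n j ℓ a k := by
  unfold auxW
  simp only [Finset.card_filter]
  rw [aux_snoc, Finset.mul_sum, Finset.mul_sum, ← Finset.sum_add_distrib]
  refine Finset.sum_congr rfl fun ψ _ => ?_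
  simp only [aux_image, aux_tau]
  generalize hI : Finset.image ψ Finset.univ = I
  have : ∀ x : Fin n, (if (insert x I).card = a+1 ∧
      k ≤ tau j ψ + (if x ∈ I ∧ I.card = j then 1 else 0) then 1 else 0)
      = if x ∈ I then (if I.card = a+1 ∧ k ≤ tau j ψ + (if I.card = j then 1 else 0) then 1 else 0)
        else (if I.card = a ∧ k ≤ tau j ψ then 1 else 0) := by
    intro x
    by_cases hx : x ∈ I
    · simp [hx]
    · simp [hx]
  rw [Finset.sum_congr rfl (fun x _ => this x), aux_sum]
  congr 1
  · by_cases h : I.card = a+1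
    · by_cases h2 : a+1 = j
      · simp [h, h2]
      · simp [h, h2]
    · simp [h]
  · by_cases h : I.card = a
    · simp [h]
    · simp [h]

theorem aux_path_succ (n m j ℓ k : ℕ) :
    ((pathSet n (m+1) (ℓ+1)).filter (fun χ => k ≤ tau j χ)).card = (n-m) * auxW n j ℓ m k := by
  unfold auxW pathSet
  rw [Finset.filter_filter]
  simp only [Finset.card_filter]
  rw [aux_snoc, Finset.mul_sum]
  refine Finset.sum_congr rfl fun ψ _ => ?_
  have h0 : ∀ x : Fin n, (∀ t s : Fin (ℓ+1), (t : ℕ) < ℓ + 1 - 1 → (s : ℕ) = ℓ + 1 - 1 →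
      (Fin.snoc ψ x : Fin (ℓ+1) → Fin n) t ≠ (Fin.snoc ψ x : Fin (ℓ+1) → Fin n) s) ↔
      x ∉ Finset.image ψ Finset.univ := by
    intro x
    constructor
    · intro h hx
      simp only [Finset.mem_image, Finset.mem_univ, true_and] at hx
      obtain ⟨t, ht⟩ := hx
      have := h t.castSucc (Fin.last ℓ) (by simp) (by simp)
      simp [ht] at this
    · intro h t s ht hs
      have hs' : s = Fin.last ℓ := Fin.ext (by simpa using hs)
      obtain ⟨t', rfl⟩ : ∃ t' : Fin ℓ, t = t'.castSucc := ⟨⟨t, by simpa using ht⟩, rfl⟩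
      subst hs'
      simp only [Fin.snoc_castSucc, Fin.snoc_last]
      intro e
      exact h (by simp [← e])
  simp only [h0, aux_image, aux_tau]
  generalize hI : Finset.image ψ Finset.univ = I
  have : ∀ x : Fin n, (if ((insert x I).card = m+1 ∧ x ∉ I) ∧
      k ≤ tau j ψ + (if x ∈ I ∧ I.card = j then 1 else 0) then 1 else 0)
      = if x ∈ I then 0
        else (if I.card = m ∧ k ≤ tau j ψ then 1 else 0) := by
    intro x
    by_cases hx : x ∈ I
    · simp [hx]
    · simp [hx]
  rw [Finset.sum_congr rfl (fun x _ => this x), aux_sum]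
  by_cases h : I.card = m
  · simp [h]
  · simp [h]

theorem auxW_zero (n j a k : ℕ) (ha : 1 ≤ a) : auxW n j 0 a k = 0 := by
  unfold auxW
  rw [Finset.card_eq_zero, Finset.filter_eq_empty_iff]
  intro χ _ h
  have := h.1
  simp at this
  omega

theorem auxW_small (n j ℓ a k : ℕ) (ha : a < j) (hk : 1 ≤ k) : auxW n j ℓ a k = 0 := by
  unfold auxW
  rw [Finset.card_eq_zero, Finset.filter_eq_empty_iff]
  rintro χ _ ⟨h1, h2⟩
  have : tau j χ = 0 := by
    unfold tau
    rw [Finset.card_eq_zero, Finset.filter_eq_empty_iff]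
    rintro t _ ⟨_, h⟩
    have : (prior χ t).card ≤ (Finset.image χ Finset.univ).card :=
      Finset.card_le_card (Finset.image_subset_image (Finset.filter_subset _ _))
    omega
  omega

theorem auxW_main (n j : ℕ) (hj : 1 ≤ j) (ℓ : ℕ) : ∀ a k, j ≤ a →
    auxW n j ℓ a k = j ^ k * auxW n j (ℓ - k) a 0 := by
  induction ℓ with
  | zero =>
    intro a k ha
    rw [Nat.zero_sub, auxW_zero _ _ _ _ (by omega), auxW_zero _ _ _ _ (by omega), mul_zero]
  | succ ℓ ih =>
    intro a k ha
    obtain _ | k := k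
    · simp
    obtain ⟨a, rfl⟩ : ∃ b, a = b + 1 := ⟨a - 1, by omega⟩
    rw [auxW_succ, Nat.add_sub_add_right ℓ 1 k]
    by_cases h : a + 1 = j
    · rw [if_pos h, auxW_small n j ℓ a (k+1) (by omega) (by omega), Nat.add_sub_cancel,
        ih _ _ ha, h, pow_succ]
      ring
    · rw [if_neg h, ih _ _ ha, ih a (k+1) (by omega)]
      by_cases hk : k + 1 ≤ ℓ
      · obtain ⟨r, rfl⟩ : ∃ r, ℓ = k + 1 + r := ⟨ℓ - (k+1), by omega⟩
        have e1 : k + 1 + r - (k + 1) = r := by omega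
        have e2 : k + 1 + r - k = r + 1 := by omega
        rw [e1, e2, auxW_succ, if_neg h]
        ring
      · have e1 : ℓ - (k + 1) = 0 := by omega
        have e2 : ℓ - k = 0 := by omega
        rw [e1, e2, auxW_zero _ _ _ _ (by omega), auxW_zero _ _ _ _ (by omega)]
        simp

/-- The number of sequences `χ ∈ 𝒳_m^{(ℓ)}` with `τ_j(χ) ≥ k` equals `j^k·|𝒳_m^{(ℓ−k)}|`. -/
theorem card_tau_ge (n m j ℓ k : ℕ) (hm : 1 ≤ m) (hmn : m ≤ n) (hj : 1 ≤ j)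
    (hjm : j ≤ m - 1) (hℓ : m ≤ ℓ) (hk : 1 ≤ k) :
    ((pathSet n m ℓ).filter (fun χ => k ≤ tau j χ)).card
      = j ^ k * (pathSet n m (ℓ - k)).card := by
  obtain ⟨m, rfl⟩ : ∃ b, m = b + 1 := ⟨m - 1, by omega⟩
  obtain ⟨ℓ, rfl⟩ : ∃ b, ℓ = b + 1 := ⟨ℓ - 1, by omega⟩
  have hjm' : j ≤ m := by omega
  rw [aux_path_succ, auxW_main n j hj ℓ m k hjm']
  by_cases h : k ≤ ℓ
  · have e : ℓ + 1 - k = (ℓ - k) + 1 := by omega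
    have := aux_path_succ n m j (ℓ - k) 0
    simp only [Nat.zero_le, Finset.filter_true] at this
    rw [e, this]
    ring
  · have e1 : ℓ - k = 0 := by omega
    have e2 : ℓ + 1 - k = 0 := by omega
    rw [e1, e2, auxW_zero _ _ _ _ (by omega)]
    have : pathSet n (m+1) 0 = ∅ := by
      unfold pathSet
      rw [Finset.filter_eq_empty_iff]
      intro χ _ h
      have := h.1
      simp at this
    simp [this]
end

section
/- For all integers n, m, j with 2 ≤ m ≤ n and 1 ≤ j ≤ m−1, the expected value of τ_j satisfies Σ_{ℓ=m}^∞ n^{−ℓ}·Σ_{χ∈𝒳_m^{(ℓ)}} τ_j(χ) = j/(n−j). -/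
theorem aux_hasSum (u v : ℕ → ℝ) (c V : ℝ) (hc0 : 0 ≤ c) (hc : c < 1) (hu : ∀ l, 0 ≤ u l)
    (hv : ∀ l, 0 ≤ v l) (hV : HasSum v V) (h : ∀ l, u (l + 1) = c * u l + v l) :
    HasSum u ((u 0 + V) / (1 - c)) := by
  have hc1 : 0 < 1 - c := by linarith
  have hs : Summable u := by
    refine summable_of_sum_range_le (c := (u 0 + V) / (1 - c)) hu ?_
    intro N
    have h1 : ∑ i ∈ Finset.range (N + 1), u i
        = c * ∑ i ∈ Finset.range N, u i + ∑ i ∈ Finset.range N, v i + u 0 := by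
      rw [Finset.sum_range_succ', Finset.mul_sum, ← Finset.sum_add_distrib]
      simp [h]
    have h2 : ∑ i ∈ Finset.range N, v i ≤ V := sum_le_hasSum _ (fun i _ => hv i) hV
    rw [Finset.sum_range_succ] at h1
    rw [le_div_iff₀ hc1]
    have := hu N
    linarith
  have h3 := hs.hasSum
  have h4 : HasSum (fun l => u (l + 1)) (c * (∑' l, u l) + V) := by
    simp_rw [h]
    exact (h3.mul_left c).add hV
  have h5 := (hasSum_nat_add_iff' 1).2 h3
  have h6 := h4.unique h5
  simp at h6
  have : (u 0 + V) / (1 - c) = ∑' l, u l := by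
    rw [div_eq_iff hc1.ne']
    linarith
  rw [this]
  exact h3

theorem image_snoc' {n l : ℕ} (χ : Fin l → Fin n) (x : Fin n) :
    Finset.image (Fin.snoc χ x : Fin (l + 1) → Fin n) Finset.univ
      = insert x (Finset.image χ Finset.univ) := by
  ext y
  simp [Fin.exists_fin_succ', or_comm, eq_comm]

theorem prior_castSucc {n l : ℕ} (χ : Fin l → Fin n) (x : Fin n) (t : Fin l) :
    prior (Fin.snoc χ x : Fin (l + 1) → Fin n) t.castSucc = prior χ t := by
  ext y
  simp only [prior, Finset.mem_image, Finset.mem_filter, Finset.mem_univ, true_and,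
    Fin.exists_fin_succ', Fin.snoc_castSucc, Fin.castSucc_lt_castSucc_iff, Fin.snoc_last]
  have : ¬ Fin.last l < t.castSucc := not_lt.2 (Fin.le_last _)
  simp [this]

theorem prior_last {n l : ℕ} (χ : Fin l → Fin n) (x : Fin n) :
    prior (Fin.snoc χ x : Fin (l + 1) → Fin n) (Fin.last l) = Finset.image χ Finset.univ := by
  ext y
  simp [prior, Fin.exists_fin_succ', Fin.castSucc_lt_last]

theorem tau_snoc {n l : ℕ} (j : ℕ) (χ : Fin l → Fin n) (x : Fin n) :
    tau j (Fin.snoc χ x : Fin (l + 1) → Fin n) = tau j χ +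
      if x ∈ Finset.image χ Finset.univ ∧ (Finset.image χ Finset.univ).card = j
        then 1 else 0 := by
  unfold tau
  rw [Finset.card_filter, Finset.card_filter, Fin.sum_univ_castSucc]
  simp only [prior_castSucc, prior_last, Fin.snoc_castSucc, Fin.snoc_last]

theorem sum_snoc {n l : ℕ} (f : (Fin (l + 1) → Fin n) → ℝ) :
    ∑ χ, f χ = ∑ χ : Fin l → Fin n, ∑ x : Fin n, f (Fin.snoc χ x) := by
  rw [← Fintype.sum_prod_type', ← (Fin.snocEquiv (fun _ : Fin (l + 1) => Fin n)).sum_comp,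
    ← (Equiv.prodComm (Fin n) (Fin l → Fin n)).sum_comp]
  rfl

theorem sum_split {n : ℕ} (S : Finset (Fin n)) (a b : ℝ) :
    ∑ x : Fin n, (if x ∈ S then a else b) = S.card * a + (n - S.card) * b := by
  have h : ∀ x : Fin n, (if x ∈ S then a else b) = b + if x ∈ S then a - b else 0 := by
    intro x; split_ifs <;> ring
  simp_rw [h]
  rw [Finset.sum_add_distrib, ← Finset.sum_filter]
  simp
  ring

noncomputable def cA (n l k : ℕ) : ℝ :=
  ∑ χ : Fin l → Fin n, if (Finset.image χ Finset.univ).card = k then 1 else 0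

noncomputable def cB (n j l k : ℕ) : ℝ :=
  ∑ χ : Fin l → Fin n, if (Finset.image χ Finset.univ).card = k then (tau j χ : ℝ) else 0

theorem cA_succ (n l k : ℕ) :
    cA n (l + 1) (k + 1) = (k + 1) * cA n l (k + 1) + (n - k) * cA n l k := by
  unfold cA
  rw [sum_snoc, Finset.mul_sum, Finset.mul_sum, ← Finset.sum_add_distrib]
  refine Finset.sum_congr rfl fun χ _ => ?_
  set S := Finset.image χ Finset.univ with hS
  have h : ∀ x : Fin n, (if (Finset.image (Fin.snoc χ x : Fin (l + 1) → Fin n) Finset.univ).card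
      = k + 1 then (1 : ℝ) else 0) =
      if x ∈ S then (if S.card = k + 1 then 1 else 0) else (if S.card = k then 1 else 0) := by
    intro x
    rw [image_snoc', Finset.card_insert_eq_ite]
    by_cases hx : x ∈ S <;> simp [hx, ← hS]
  rw [Finset.sum_congr rfl fun x _ => h x, sum_split]
  congr 1
  · split_ifs with h1 <;> simp [h1]
  · split_ifs with h1 <;> simp [h1]

theorem cB_succ (n j l k : ℕ) :
    cB n j (l + 1) (k + 1) = (k + 1) * cB n j l (k + 1) + ((n - k) * cB n j l k +
      if k + 1 = j then j * cA n l j else 0) := by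
  have h0 : (if k + 1 = j then j * cA n l j else 0) = ∑ χ : Fin l → Fin n,
      if k + 1 = j ∧ (Finset.image χ Finset.univ).card = j then (j : ℝ) else 0 := by
    unfold cA
    split_ifs with h
    · rw [Finset.mul_sum]
      refine Finset.sum_congr rfl fun χ _ => ?_
      simp [h]
    · simp [h]
  rw [h0]
  unfold cB
  rw [sum_snoc, Finset.mul_sum, Finset.mul_sum, ← Finset.sum_add_distrib,
    ← Finset.sum_add_distrib]
  refine Finset.sum_congr rfl fun χ _ => ?_
  set S := Finset.image χ Finset.univ with hS
  have h : ∀ x : Fin n, (if (Finset.image (Fin.snoc χ x : Fin (l + 1) → Fin n) Finset.univ).card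
      = k + 1 then (tau j (Fin.snoc χ x : Fin (l + 1) → Fin n) : ℝ) else 0) =
      if x ∈ S then (if S.card = k + 1 then (tau j χ : ℝ) + (if k + 1 = j then 1 else 0) else 0)
        else (if S.card = k then (tau j χ : ℝ) else 0) := by
    intro x
    rw [image_snoc', Finset.card_insert_eq_ite, tau_snoc, ← hS]
    by_cases hx : x ∈ S
    · by_cases h1 : S.card = k + 1 <;> simp [hx, h1]
    · simp [hx]
  rw [Finset.sum_congr rfl fun x _ => h x, sum_split]
  by_cases h1 : S.card = k + 1
  · by_cases h2 : k + 1 = j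
    · subst h2; simp [h1]; ring
    · simp [h1, h2]
  · have : ¬ (k + 1 = j ∧ S.card = j) := by omega
    rw [if_neg h1, if_neg h1, if_neg this]
    by_cases h3 : S.card = k <;> simp [h3]

theorem path_sum (n m j l : ℕ) :
    ∑ χ ∈ pathSet n (m + 1) (l + 1), (tau j χ : ℝ) = (n - m) * cB n j l m := by
  unfold pathSet cB
  rw [Finset.sum_filter, sum_snoc, Finset.mul_sum]
  refine Finset.sum_congr rfl fun χ _ => ?_
  set S := Finset.image χ Finset.univ with hS
  have h : ∀ x : Fin n, (if (Finset.image (Fin.snoc χ x : Fin (l + 1) → Fin n) Finset.univ).card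
      = m + 1 ∧ (∀ t s : Fin (l + 1), (t : ℕ) < l + 1 - 1 → (s : ℕ) = l + 1 - 1 →
        (Fin.snoc χ x : Fin (l + 1) → Fin n) t ≠ (Fin.snoc χ x : Fin (l + 1) → Fin n) s)
      then (tau j (Fin.snoc χ x : Fin (l + 1) → Fin n) : ℝ) else 0) =
      if x ∈ S then 0 else (if S.card = m then (tau j χ : ℝ) else 0) := by
    intro x
    have h2 : (∀ t s : Fin (l + 1), (t : ℕ) < l + 1 - 1 → (s : ℕ) = l + 1 - 1 →
        (Fin.snoc χ x : Fin (l + 1) → Fin n) t ≠ (Fin.snoc χ x : Fin (l + 1) → Fin n) s)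
        ↔ x ∉ S := by
      constructor
      · intro h hx
        obtain ⟨t, -, rfl⟩ := Finset.mem_image.1 hx
        have := h t.castSucc (Fin.last l) (by simp) (by simp)
        simp at this
      · intro hx t s ht hs
        have hs' : s = Fin.last l := Fin.ext (by simpa using hs)
        subst hs'
        obtain ⟨t', rfl⟩ : ∃ t' : Fin l, t = t'.castSucc := ⟨⟨t, by omega⟩, rfl⟩
        simp only [Fin.snoc_castSucc, Fin.snoc_last]
        rintro rfl
        exact hx (by simp [hS])
    simp only [h2]
    rw [image_snoc', Finset.card_insert_eq_ite, tau_snoc, ← hS]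
    by_cases hx : x ∈ S <;> simp [hx]
  rw [Finset.sum_congr rfl fun x _ => h x, sum_split]
  split_ifs with h1 <;> simp [h1]

theorem cA_zero_zero (n : ℕ) : cA n 0 0 = 1 := by simp [cA]

theorem cA_zero_succ (n k : ℕ) : cA n 0 (k + 1) = 0 := by simp [cA]

theorem cA_succ_zero (n l : ℕ) : cA n (l + 1) 0 = 0 := by
  unfold cA
  refine Finset.sum_eq_zero fun χ _ => ?_
  rw [if_neg]
  simp [Finset.univ_eq_empty_iff]

theorem cB_zero (n j k : ℕ) : cB n j 0 k = 0 := by simp [cB, tau]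

theorem cB_succ_zero (n j l : ℕ) : cB n j l 0 = 0 := by
  cases l with
  | zero => exact cB_zero _ _ _
  | succ l =>
    unfold cB
    refine Finset.sum_eq_zero fun χ _ => ?_
    rw [if_neg]
    simp [Finset.univ_eq_empty_iff]

theorem cA_nonneg (n l k : ℕ) : 0 ≤ cA n l k :=
  Finset.sum_nonneg fun χ _ => by split_ifs <;> norm_num

theorem cB_nonneg (n j l k : ℕ) : 0 ≤ cB n j l k :=
  Finset.sum_nonneg fun χ _ => by split_ifs <;> positivity

theorem hasSum_A (n k : ℕ) (hk : k < n) :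
    HasSum (fun l => cA n l k / (n : ℝ) ^ l) ((n : ℝ) / (n - k)) := by
  have hn : (0 : ℝ) < n := by exact_mod_cast (by omega : 0 < n)
  induction k with
  | zero =>
    have := hasSum_single (f := fun l => cA n l 0 / (n : ℝ) ^ l) 0 (by
      intro l hl
      obtain ⟨l, rfl⟩ := Nat.exists_eq_succ_of_ne_zero hl
      simp [cA_succ_zero])
    simpa [cA_zero_zero, hn.ne'] using this
  | succ k ih =>
    have hk' : (k : ℝ) + 1 < n := by exact_mod_cast hk
    have hd : (n : ℝ) - k ≠ 0 := by linarith
    have hd' : (n : ℝ) - (k + 1) ≠ 0 := by linarith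
    have h := aux_hasSum (fun l => cA n l (k + 1) / (n : ℝ) ^ l)
      (fun l => ((n - k) / n) * (cA n l k / (n : ℝ) ^ l)) ((k + 1) / n) _
      (by positivity) (by rwa [div_lt_one hn])
      (fun l => div_nonneg (cA_nonneg _ _ _) (by positivity))
      (fun l => mul_nonneg (div_nonneg (by linarith) hn.le)
        (div_nonneg (cA_nonneg _ _ _) (by positivity)))
      ((ih (by omega)).mul_left _)
      (fun l => by
        simp only [cA_succ]
        field_simp
        ring)
    convert h using 1
    simp only [cA_zero_succ]
    push_cast
    field_simp
    simp

theorem hasSum_B (n j k : ℕ) (hj : 1 ≤ j) (hk : k < n) :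
    HasSum (fun l => cB n j l k / (n : ℝ) ^ l)
      (if j ≤ k then (j * n : ℝ) / ((n - j) * (n - k)) else 0) := by
  have hn : (0 : ℝ) < n := by exact_mod_cast (by omega : 0 < n)
  induction k with
  | zero =>
    rw [if_neg (by omega)]
    simpa [cB_succ_zero] using (hasSum_zero : HasSum (fun _ : ℕ => (0 : ℝ)) 0)
  | succ k ih =>
    have hk' : (k : ℝ) + 1 < n := by exact_mod_cast hk
    have hd : (n : ℝ) - k ≠ 0 := by linarith
    have hd' : (n : ℝ) - (k + 1) ≠ 0 := by linarith
    have hC : HasSum (fun l => if k + 1 = j then (j / n : ℝ) * (cA n l j / (n : ℝ) ^ l) else 0)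
        (if k + 1 = j then (j / n : ℝ) * (n / (n - j)) else 0) := by
      split_ifs with h
      · exact (hasSum_A n j (by omega)).mul_left _
      · exact hasSum_zero
    have h := aux_hasSum (fun l => cB n j l (k + 1) / (n : ℝ) ^ l)
      (fun l => ((n - k) / n) * (cB n j l k / (n : ℝ) ^ l) +
        if k + 1 = j then (j / n : ℝ) * (cA n l j / (n : ℝ) ^ l) else 0) ((k + 1) / n) _
      (by positivity) (by rwa [div_lt_one hn])
      (fun l => div_nonneg (cB_nonneg _ _ _ _) (by positivity))
      (fun l => add_nonneg (mul_nonneg (div_nonneg (by linarith) hn.le)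
        (div_nonneg (cB_nonneg _ _ _ _) (by positivity))) (by
          have := cA_nonneg n l j
          split_ifs <;> positivity))
      (((ih (by omega)).mul_left _).add hC)
      (fun l => by
        simp only [cB_succ]
        split_ifs
        · field_simp
          ring
        · field_simp
          ring)
    convert h using 1
    simp only [cB_zero]
    rcases lt_trichotomy j (k + 1) with h1 | h1 | h1
    · have hj' : (j : ℝ) < n := by exact_mod_cast (by omega : j < n)
      have hd2 : (n : ℝ) - j ≠ 0 := by linarith
      rw [if_pos h1.le, if_pos (by omega), if_neg (by omega)]
      push_cast
      field_simp
      simp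
    · subst h1
      rw [if_pos le_rfl, if_neg (by omega), if_pos rfl]
      push_cast
      field_simp
      simp
    · rw [if_neg (by omega), if_neg (by omega), if_neg (by omega)]
      simp

/-- The expected value of `τ_j` satisfies `Σ_{ℓ=m}^∞ n^{−ℓ}·Σ_{χ∈𝒳_m^{(ℓ)}} τ_j(χ) = j/(n−j)`.
(The terms with `ℓ < m` vanish since `𝒳_m^{(ℓ)} = ∅` for `ℓ < m`.) -/
theorem expected_tau (n m j : ℕ) (hm : 2 ≤ m) (hmn : m ≤ n) (hj : 1 ≤ j) (hjm : j ≤ m - 1) :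
    ∑' ℓ : ℕ, (∑ χ ∈ pathSet n m ℓ, (tau j χ : ℝ)) / n ^ ℓ = (j : ℝ) / ((n : ℝ) - j) := by
  obtain ⟨m, rfl⟩ : ∃ k, m = k + 1 := ⟨m - 1, by omega⟩
  have hn : (0 : ℝ) < n := by exact_mod_cast (by omega : 0 < n)
  have hm' : (m : ℝ) < n := by exact_mod_cast (by omega : m < n)
  have hj' : (j : ℝ) < n := by exact_mod_cast (by omega : j < n)
  have hd : (n : ℝ) - m ≠ 0 := by linarith
  have hd2 : (n : ℝ) - j ≠ 0 := by linarith
  have h := (hasSum_B n j m hj (by omega)).mul_left (((n : ℝ) - m) / n)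
  rw [if_pos (by omega)] at h
  have h0 : ∑ χ ∈ pathSet n (m + 1) 0, (tau j χ : ℝ) = 0 := by
    refine Finset.sum_eq_zero fun χ _ => ?_
    simp [tau]
  have h2 : HasSum (fun l : ℕ => (∑ χ ∈ pathSet n (m + 1) l, (tau j χ : ℝ)) / (n : ℝ) ^ l)
      ((j : ℝ) / ((n : ℝ) - j)) := by
    rw [← hasSum_nat_add_iff' 1]
    simp only [path_sum, Finset.sum_range_one, h0]
    have e1 : (j : ℝ) / (n - j) - 0 / (n : ℝ) ^ 0
        = (n - m) / n * (j * n / ((n - j) * (n - m))) := by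
      simp only [zero_div, sub_zero]
      field_simp
    rw [e1]
    have e2 : (fun l : ℕ => ((n : ℝ) - m) * cB n j l m / (n : ℝ) ^ (l + 1))
        = fun l : ℕ => ((n : ℝ) - m) / n * (cB n j l m / (n : ℝ) ^ l) := by
      ext l
      rw [pow_succ]
      field_simp
    rw [e2]
    exact h
  exact h2.tsum_eq
end

section
/- For all integers n, m with 1 < m ≤ n and m < 4·b(n), one has F(m) < F(1) = 2·b(n). -/
/-- `E_m[τ_j/ℓ] := Σ_{ℓ=m}^∞ (1/(ℓ·n^ℓ))·Σ_{χ∈𝒳_m^{(ℓ)}} τ_j(χ)`.  (The terms with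
`ℓ < m` vanish since `𝒳_m^{(ℓ)} = ∅` for `ℓ < m`.) -/
noncomputable def Etau (n m j : ℕ) : ℝ :=
  ∑' ℓ : ℕ, (∑ χ ∈ pathSet n m ℓ, (tau j χ : ℝ)) / (ℓ * n ^ ℓ)

/-- `E_m[1/ℓ] := Σ_{ℓ=m}^∞ |𝒳_m^{(ℓ)}|/(ℓ·n^ℓ)`, the expected reciprocal of the waiting
time until `m` distinct values have appeared in i.i.d. uniform draws from an `n`-element
set.  (The terms with `ℓ < m` vanish since `𝒳_m^{(ℓ)} = ∅` for `ℓ < m`.) -/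
noncomputable def ErecipP (n m : ℕ) : ℝ :=
  ∑' ℓ : ℕ, ((pathSet n m ℓ).card : ℝ) / (ℓ * n ^ ℓ)

/-- `b(n) := (1 + 1/n)·log₂(n+1) − 1`, the average cost of a successful binary search
among `n` sorted items. -/
noncomputable def bcost (n : ℕ) : ℝ := (1 + 1 / (n : ℝ)) * Real.logb 2 ((n : ℝ) + 1) - 1

/-- `F(m) := 2·m·b(n)·E_m[1/ℓ] + Σ_{j=1}^{m−1} ((j+1)/2)·E_m[τ_j/ℓ]`, the expected
per-search cost of the search-with-cleanup process in the complete-memory,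
numbered-shelves model `𝓜₄` with uniform distribution, when one cleans up as soon as
the pile reaches size `m`. -/
noncomputable def Fcost (n m : ℕ) : ℝ :=
  2 * m * bcost n * ErecipP n m +
    ∑ j ∈ Finset.Icc 1 (m - 1), (((j : ℝ) + 1) / 2) * Etau n m j

def smallSet (n m ℓ : ℕ) : Finset (Fin ℓ → Fin n) :=
  Finset.univ.filter (fun χ => (Finset.image χ Finset.univ).card < m)

theorem image_init_subset {n ℓ : ℕ} (χ : Fin (ℓ + 1) → Fin n) :
    Finset.image (Fin.init χ : Fin ℓ → Fin n) Finset.univ ⊆ Finset.image χ Finset.univ := by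
  intro x hx
  simp only [Finset.mem_image, Finset.mem_univ, true_and] at hx ⊢
  obtain ⟨t, rfl⟩ := hx
  exact ⟨t.castSucc, rfl⟩

theorem init_lt {n m ℓ : ℕ} (χ : Fin (ℓ + 1) → Fin n) (h : χ ∈ pathSet n m (ℓ + 1)) :
    (Finset.image (Fin.init χ : Fin ℓ → Fin n) Finset.univ).card < m := by
  simp only [pathSet, Finset.mem_filter, Finset.mem_univ, true_and] at h
  obtain ⟨h1, h2⟩ := h
  rw [← h1]
  apply Finset.card_lt_card
  refine ⟨image_init_subset χ, fun hs => ?_⟩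
  have : χ (Fin.last ℓ) ∈ Finset.image (Fin.init χ : Fin ℓ → Fin n) Finset.univ :=
    hs (Finset.mem_image_of_mem _ (Finset.mem_univ _))
  simp only [Finset.mem_image, Finset.mem_univ, true_and] at this
  obtain ⟨t, ht⟩ := this
  exact h2 t.castSucc (Fin.last ℓ) (by simp) (by simp) ht

theorem step_le (n m ℓ : ℕ) :
    (pathSet n m (ℓ + 1)).card + (smallSet n m (ℓ + 1)).card ≤ n * (smallSet n m ℓ).card := by
  classical
  have hd : Disjoint (pathSet n m (ℓ + 1)) (smallSet n m (ℓ + 1)) := by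
    rw [Finset.disjoint_left]
    intro χ h1 h2
    simp only [pathSet, smallSet, Finset.mem_filter, Finset.mem_univ, true_and] at h1 h2
    omega
  rw [← Finset.card_union_of_disjoint hd]
  have hc : n * (smallSet n m ℓ).card
      = ((Finset.univ : Finset (Fin n)) ×ˢ smallSet n m ℓ).card := by
    simp [Finset.card_product]
  rw [hc]
  apply Finset.card_le_card_of_injOn (fun χ => (χ (Fin.last ℓ), (Fin.init χ : Fin ℓ → Fin n)))
  · intro χ hχ
    simp only [Finset.coe_product, Set.mem_prod, Finset.mem_coe, Finset.mem_univ, true_and]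
    simp only [smallSet, Finset.mem_filter, Finset.mem_univ, true_and]
    rcases Finset.mem_union.1 hχ with h | h
    · exact init_lt χ h
    · simp only [smallSet, Finset.mem_filter, Finset.mem_univ, true_and] at h
      exact lt_of_le_of_lt (Finset.card_le_card (image_init_subset χ)) h
  · intro χ _ ψ _ h
    simp only [Prod.mk.injEq] at h
    rw [← Fin.snoc_init_self χ, ← Fin.snoc_init_self ψ, h.1, h.2]

theorem pathSet_zero (n m : ℕ) (hm : 0 < m) : pathSet n m 0 = ∅ := by
  simp only [pathSet, Finset.filter_eq_empty_iff]
  intro χ _ h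
  have := h.1
  simp at this
  omega

theorem partial_le (n m : ℕ) (hm : 0 < m) (hn : 0 < n) (N : ℕ) :
    ∑ ℓ ∈ Finset.range (N + 1), ((pathSet n m ℓ).card : ℝ) / n ^ ℓ
      + (smallSet n m N).card / n ^ N ≤ 1 := by
  have hn' : (0 : ℝ) < n := by exact_mod_cast hn
  induction N with
  | zero =>
    have h : (smallSet n m 0).card ≤ 1 := by
      refine (Finset.card_le_univ _).trans ?_
      simp
    simp [pathSet_zero n m hm]
    exact_mod_cast h
  | succ N ih =>
    rw [Finset.sum_range_succ]
    have h : ((pathSet n m (N + 1)).card : ℝ) + (smallSet n m (N + 1)).card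
        ≤ n * (smallSet n m N).card := by exact_mod_cast step_le n m N
    have h2 : ((pathSet n m (N + 1)).card : ℝ) / n ^ (N + 1)
        + (smallSet n m (N + 1)).card / n ^ (N + 1) ≤ (smallSet n m N).card / n ^ N := by
      rw [← add_div, div_le_div_iff₀ (by positivity) (by positivity)]
      calc _ ≤ (n * (smallSet n m N).card : ℝ) * n ^ N := by gcongr
        _ = _ := by ring
    linarith

theorem partial_le' (n m : ℕ) (hm : 0 < m) (hn : 0 < n) (N : ℕ) :
    ∑ ℓ ∈ Finset.range N, ((pathSet n m ℓ).card : ℝ) / n ^ ℓ ≤ 1 := by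
  have h := partial_le n m hm hn N
  rw [Finset.sum_range_succ] at h
  have h1 : (0 : ℝ) ≤ ((pathSet n m N).card : ℝ) / n ^ N := by positivity
  have h2 : (0 : ℝ) ≤ ((smallSet n m N).card : ℝ) / n ^ N := by positivity
  linarith

theorem summ_p (n m : ℕ) (hm : 0 < m) (hn : 0 < n) :
    Summable (fun ℓ : ℕ => ((pathSet n m ℓ).card : ℝ) / n ^ ℓ) :=
  summable_of_sum_range_le (fun _ => by positivity) (partial_le' n m hm hn)

theorem tsum_p (n m : ℕ) (hm : 0 < m) (hn : 0 < n) :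
    ∑' ℓ : ℕ, ((pathSet n m ℓ).card : ℝ) / n ^ ℓ ≤ 1 :=
  Real.tsum_le_of_sum_range_le (fun _ => by positivity) (partial_le' n m hm hn)

theorem tau_le {n ℓ : ℕ} (j : ℕ) (χ : Fin ℓ → Fin n) : tau j χ ≤ ℓ := by
  refine (Finset.card_le_univ _).trans ?_
  simp

theorem summ_tau (n m j : ℕ) (hm : 0 < m) (hn : 0 < n) :
    Summable (fun ℓ : ℕ => (∑ χ ∈ pathSet n m ℓ, (tau j χ : ℝ)) / (ℓ * n ^ ℓ)) := by
  refine Summable.of_nonneg_of_le (fun _ => by positivity) (fun ℓ => ?_) (summ_p n m hm hn)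
  rcases Nat.eq_zero_or_pos ℓ with rfl | hl
  · simp
  have hn' : (0 : ℝ) < n := by exact_mod_cast hn
  have hl' : (0 : ℝ) < ℓ := by exact_mod_cast hl
  have : ∑ χ ∈ pathSet n m ℓ, (tau j χ : ℝ) ≤ (pathSet n m ℓ).card * ℓ := by
    rw [← nsmul_eq_mul]
    exact Finset.sum_le_card_nsmul _ _ _ (fun χ _ => by exact_mod_cast tau_le j χ)
  rw [div_le_div_iff₀ (by positivity) (by positivity)]
  calc _ ≤ ((pathSet n m ℓ).card * ℓ : ℝ) * n ^ ℓ := by gcongr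
    _ = _ := by ring

theorem summ_r (n m : ℕ) (hm : 0 < m) (hn : 0 < n) :
    Summable (fun ℓ : ℕ => ((pathSet n m ℓ).card : ℝ) / (ℓ * n ^ ℓ)) := by
  refine Summable.of_nonneg_of_le (fun _ => by positivity) (fun ℓ => ?_) (summ_p n m hm hn)
  rcases Nat.eq_zero_or_pos ℓ with rfl | hl
  · simp
  have hn' : (0 : ℝ) < n := by exact_mod_cast hn
  have hl' : (1 : ℝ) ≤ ℓ := by exact_mod_cast hl
  apply div_le_div_of_nonneg_left (by positivity) (by positivity)
  exact le_mul_of_one_le_left (by positivity) hl'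

theorem sum_tau_le {n m ℓ : ℕ} (χ : Fin ℓ → Fin n) (h : χ ∈ pathSet n m ℓ) :
    ∑ j ∈ Finset.Icc 1 (m - 1), tau j χ + m ≤ ℓ := by
  classical
  have h1 : (Finset.image χ Finset.univ).card = m := by
    simp only [pathSet, Finset.mem_filter, Finset.mem_univ, true_and] at h
    exact h.1
  have hA : ∑ j ∈ Finset.Icc 1 (m - 1), tau j χ
      ≤ (Finset.univ.filter (fun t => χ t ∈ prior χ t)).card := by
    simp only [tau]
    rw [← Finset.card_biUnion]
    · apply Finset.card_le_card
      intro t ht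
      simp only [Finset.mem_biUnion, Finset.mem_filter, Finset.mem_univ, true_and] at ht ⊢
      obtain ⟨_, _, h, _⟩ := ht
      exact h
    · intro i _ j _ hij
      rw [Function.onFun, Finset.disjoint_left]
      intro t h1 h2
      simp only [Finset.mem_filter, Finset.mem_univ, true_and] at h1 h2
      exact hij (h1.2.symm.trans h2.2)
  have hB : m ≤ (Finset.univ.filter (fun t => ¬ χ t ∈ prior χ t)).card := by
    rw [← h1]
    refine le_trans (Finset.card_le_card ?_)
      (Finset.card_image_le (s := Finset.univ.filter (fun t => ¬ χ t ∈ prior χ t)) (f := χ))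
    have key : ∀ k : ℕ, ∀ t : Fin ℓ, (t : ℕ) = k →
        χ t ∈ Finset.image χ (Finset.univ.filter (fun t => ¬ χ t ∈ prior χ t)) := by
      intro k
      induction k using Nat.strong_induction_on with
      | _ k ih =>
        intro t ht
        by_cases hp : χ t ∈ prior χ t
        · have hp' := hp
          simp only [prior, Finset.mem_image, Finset.mem_filter, Finset.mem_univ, true_and] at hp'
          obtain ⟨s, hs, he⟩ := hp'
          rw [← he]
          exact ih s (by rw [← ht]; exact hs) s rfl
        · exact Finset.mem_image_of_mem _ (by simpa using hp)
    intro x hx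
    simp only [Finset.mem_image, Finset.mem_univ, true_and] at hx
    obtain ⟨t, rfl⟩ := hx
    exact key t t rfl
  have hC := Finset.card_filter_add_card_filter_not (s := (Finset.univ : Finset (Fin ℓ)))
    (fun t => χ t ∈ prior χ t)
  rw [Finset.card_univ, Fintype.card_fin] at hC
  omega

theorem chi_bound {n m ℓ : ℕ} (χ : Fin ℓ → Fin n) (h : χ ∈ pathSet n m ℓ) :
    ∑ j ∈ Finset.Icc 1 (m - 1), (((j : ℝ) + 1) / 2) * tau j χ ≤ (m : ℝ) / 2 * (ℓ - m) := by
  have h1 : (∑ j ∈ Finset.Icc 1 (m - 1), (tau j χ : ℝ)) + m ≤ ℓ := by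
    exact_mod_cast sum_tau_le χ h
  calc _ ≤ ∑ j ∈ Finset.Icc 1 (m - 1), (m : ℝ) / 2 * tau j χ := by
        apply Finset.sum_le_sum
        intro j hj
        have : j + 1 ≤ m := by
          have := Finset.mem_Icc.1 hj
          omega
        have : (j : ℝ) + 1 ≤ m := by exact_mod_cast this
        gcongr
    _ = (m : ℝ) / 2 * ∑ j ∈ Finset.Icc 1 (m - 1), (tau j χ : ℝ) := by rw [Finset.mul_sum]
    _ ≤ _ := by
        gcongr
        linarith

theorem path_nonempty (n m : ℕ) (hm : 1 < m) (hmn : m ≤ n) : 0 < (pathSet n m (m + 1)).card := by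
  rw [Finset.card_pos]
  refine ⟨fun t => ⟨(t : ℕ) - 1, by omega⟩, ?_⟩
  simp only [pathSet, Finset.mem_filter, Finset.mem_univ, true_and]
  constructor
  · have : Finset.image (fun t : Fin (m + 1) => (⟨(t : ℕ) - 1, by omega⟩ : Fin n)) Finset.univ
        = Finset.univ.map (Fin.castLEEmb hmn) := by
      ext x
      simp only [Finset.mem_image, Finset.mem_univ, true_and, Finset.mem_map]
      constructor
      · rintro ⟨t, rfl⟩
        exact ⟨⟨(t : ℕ) - 1, by omega⟩, rfl⟩
      · rintro ⟨t, rfl⟩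
        exact ⟨t.succ, by ext; simp⟩
    rw [this]
    simp
  · intro t s ht hs he
    simp only [Fin.mk.injEq] at he
    omega

theorem Erecip_one (n : ℕ) (hn : 0 < n) : ErecipP n 1 = 1 := by
  have hn' : (n : ℝ) ≠ 0 := by exact_mod_cast hn.ne'
  rw [ErecipP, tsum_eq_single 1]
  · have : pathSet n 1 1 = Finset.univ := by
      simp only [pathSet, Finset.filter_eq_self]
      intro χ _
      refine ⟨by simp, fun t s ht => by omega⟩
    rw [this]
    simp [hn']
  · intro ℓ hl
    have : pathSet n 1 ℓ = ∅ := by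
      rcases ℓ with _ | ℓ
      · exact pathSet_zero n 1 one_pos
      · rw [Finset.eq_empty_iff_forall_notMem]
        intro χ hχ
        have := init_lt χ hχ
        have h0 : 0 < ℓ := by omega
        have : 0 < (Finset.image (Fin.init χ : Fin ℓ → Fin n) Finset.univ).card :=
          Finset.card_pos.2 ⟨_, Finset.mem_image_of_mem _ (Finset.mem_univ (⟨0, h0⟩ : Fin ℓ))⟩
        omega
    simp [this]

theorem Fcost_lt_Fcost_one (n m : ℕ) (hm : 1 < m) (hmn : m ≤ n) (h : (m : ℝ) < 4 * bcost n) :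
    Fcost n m < Fcost n 1 ∧ Fcost n 1 = 2 * bcost n := by
  have hn : 0 < n := by omega
  have hm0 : 0 < m := by omega
  have hn' : (0 : ℝ) < n := by exact_mod_cast hn
  have hF1 : Fcost n 1 = 2 * bcost n := by
    simp [Fcost, Erecip_one n hn]
  refine ⟨?_, hF1⟩
  rw [hF1]
  have hb : 0 < bcost n := by
    have : (0 : ℝ) < m := by exact_mod_cast hm0
    linarith
  have hsr := summ_r n m hm0 hn
  have hst := fun j => summ_tau n m j hm0 hn
  have hsp := summ_p n m hm0 hn
  have hS1 := (hsr.hasSum.mul_left (2 * m * bcost n)).add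
    (hasSum_sum (s := Finset.Icc 1 (m - 1))
      (fun j _ => (hst j).hasSum.mul_left (((j : ℝ) + 1) / 2)))
  have hS2 := hsp.hasSum.mul_left (2 * bcost n)
  have hlt : Fcost n m < 2 * bcost n * ∑' ℓ : ℕ, ((pathSet n m ℓ).card : ℝ) / n ^ ℓ := by
    have hform : ∀ ℓ : ℕ, 2 * m * bcost n * (((pathSet n m ℓ).card : ℝ) / (ℓ * n ^ ℓ))
        + ∑ j ∈ Finset.Icc 1 (m - 1), (((j : ℝ) + 1) / 2) *
          ((∑ χ ∈ pathSet n m ℓ, (tau j χ : ℝ)) / (ℓ * n ^ ℓ))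
        ≤ (pathSet n m ℓ).card * (2 * m * bcost n + (m : ℝ) / 2 * (ℓ - m)) / (ℓ * n ^ ℓ) := by
      intro ℓ
      have e : ∑ j ∈ Finset.Icc 1 (m - 1), (((j : ℝ) + 1) / 2) *
          ((∑ χ ∈ pathSet n m ℓ, (tau j χ : ℝ)) / (ℓ * n ^ ℓ))
          = (∑ χ ∈ pathSet n m ℓ, ∑ j ∈ Finset.Icc 1 (m - 1), (((j : ℝ) + 1) / 2) * tau j χ)
            / (ℓ * n ^ ℓ) := by
        rw [Finset.sum_comm, Finset.sum_div]
        apply Finset.sum_congr rfl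
        intro j _
        rw [← Finset.mul_sum, mul_div_assoc]
      have e2 : (∑ χ ∈ pathSet n m ℓ, ∑ j ∈ Finset.Icc 1 (m - 1), (((j : ℝ) + 1) / 2) * tau j χ)
          ≤ (pathSet n m ℓ).card * ((m : ℝ) / 2 * (ℓ - m)) := by
        rw [← nsmul_eq_mul]
        exact Finset.sum_le_card_nsmul _ _ _ (fun χ hχ => chi_bound χ hχ)
      rw [e, ← mul_div_assoc, ← add_div]
      gcongr
      linarith
    have hgap : ∀ ℓ : ℕ, 2 * bcost n * (((pathSet n m ℓ).card : ℝ) / n ^ ℓ)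
        - (pathSet n m ℓ).card * (2 * m * bcost n + (m : ℝ) / 2 * (ℓ - m)) / (ℓ * n ^ ℓ)
        = (pathSet n m ℓ).card * ((2 * bcost n - m / 2) * (ℓ - m)) / (ℓ * n ^ ℓ) := by
      intro ℓ
      rcases Nat.eq_zero_or_pos ℓ with rfl | hl
      · simp [pathSet_zero n m hm0]
      have hl' : (ℓ : ℝ) ≠ 0 := by exact_mod_cast hl.ne'
      field_simp
      ring
    have hc : 0 < 2 * bcost n - m / 2 := by linarith
    refine hasSum_lt (i := m + 1) ?_ ?_ hS1 hS2
    · intro ℓ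
      have h1 := hform ℓ
      have h2 := hgap ℓ
      have h3 : 0 ≤ (pathSet n m ℓ).card * ((2 * bcost n - m / 2) * (ℓ - m)) / (ℓ * n ^ ℓ) := by
        rcases (pathSet n m ℓ).eq_empty_or_nonempty with he | ⟨χ, hχ⟩
        · simp [he]
        · have h4 : m ≤ ℓ := by
            have := sum_tau_le χ hχ
            omega
          have h5 : (0 : ℝ) ≤ ℓ - m := by
            have : (m : ℝ) ≤ ℓ := by exact_mod_cast h4
            linarith
          positivity
      show _ ≤ _
      linarith
    · have h1 := hform (m + 1)
      have h2 := hgap (m + 1)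
      have h3 : 0 < (pathSet n m (m + 1)).card *
          ((2 * bcost n - m / 2) * (((m + 1 : ℕ) : ℝ) - m)) / (((m + 1 : ℕ) : ℝ) * n ^ (m + 1)) := by
        have h4 : (0 : ℝ) < (pathSet n m (m + 1)).card := by
          exact_mod_cast path_nonempty n m hm hmn
        have h5 : (0 : ℝ) < ((m + 1 : ℕ) : ℝ) - m := by push_cast; linarith
        positivity
      show _ < _
      linarith
  have := tsum_p n m hm0 hn
  nlinarith
end
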